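/- arXiv:math/0409464 — 2 statements merged into one kernel-verified Lean document; each statement's English description precedes it below -/
import Mathlib

section
/- Let N ≥ 1, let a, u : [-1,1] → ℂ be continuous, and let y_0 ∈ ℂ. Suppose y : [-1,1] → ℂ is differentiable with y'(t) = a(t)·y(t) + u(t) for all t ∈ [-1,1] and y(−1) = y_0, and suppose p is a polynomial of degree ≤ N satisfying p'(t_j) = a(t_j)·p(t_j) + u(t_j) for j = 0,…,N−1 and p(−1) = y_0. Set R_p = p'(−1) − a(−1)·y_0 − u(−1). Then ‖y' − p'‖_∞ ≤ (2·C_a·‖a‖_∞ + 1)·( ‖a·p − I_N(a·p)‖_∞ + ‖u − I_N(u)‖_∞ + |R_p| ). -/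
open Set Polynomial

/-- The Chebyshev collocation points `t_j = cos(jπ/N)`. -/
noncomputable def chebNode (N j : ℕ) : ℝ := Real.cos (j * Real.pi / N)

/-- The uniform (sup) norm of a function over `[-1,1]`. -/
noncomputable def supNorm (f : ℝ → ℂ) : ℝ := ⨆ t : Set.Icc (-1 : ℝ) 1, ‖f t‖

open Polynomial.Chebyshev in
theorem aux_U_bound (n : ℕ) (x : ℝ) (hx : |x| ≤ 1) : |(U ℝ n).eval x| ≤ n + 1 := by
  induction n with
  | zero => simp
  | succ k ih =>
    have h1 : (U ℝ ((k + 1 : ℕ) : ℤ)).eval x = x * (U ℝ k).eval x + (T ℝ (k + 1)).eval x := by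
      have := U_eq_X_mul_U_add_T ℝ (k : ℤ)
      push_cast
      rw [this]; simp
    have h2 : |(T ℝ ((k : ℤ) + 1)).eval x| ≤ 1 := abs_eval_T_real_le_one _ hx
    rw [h1]
    have h3 : |x * (U ℝ k).eval x| ≤ k + 1 := by
      rw [abs_mul]
      nlinarith [abs_nonneg x, abs_nonneg ((U ℝ k).eval x)]
    push_cast
    linarith [abs_add_le (x * (U ℝ k).eval x) ((T ℝ ((k : ℤ) + 1)).eval x)]

theorem aux_node_inj (N : ℕ) (hN : 1 ≤ N) :
    Set.InjOn (fun j : ℕ => ((chebNode N j : ℝ) : ℂ)) (Finset.range (N + 1)) := by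
  intro i hi j hj hij
  have hN' : (0 : ℝ) < N := by exact_mod_cast hN
  have key : ∀ k ∈ (Finset.range (N + 1) : Set ℕ), (k * Real.pi / N : ℝ) ∈ Icc 0 Real.pi := by
    intro k hk
    have hk' : (k : ℝ) ≤ N := by
      have : k < N + 1 := by simpa using hk
      exact_mod_cast Nat.lt_succ_iff.mp this
    refine ⟨by positivity, ?_⟩
    rw [div_le_iff₀ hN']
    nlinarith [Real.pi_pos]
  have h := Real.injOn_cos (key i hi) (key j hj) (by simpa [chebNode] using Complex.ofReal_injective hij)
  have hpi := Real.pi_pos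
  field_simp at h
  exact_mod_cast h

open Polynomial.Chebyshev in
theorem aux_resid (N : ℕ) (hN : 1 ≤ N) (r : Polynomial ℂ) (hr : r.natDegree ≤ N)
    (h0 : ∀ j < N, r.eval ((chebNode N j : ℝ) : ℂ) = 0) (t : ℝ) (ht : t ∈ Icc (-1 : ℝ) 1) :
    ‖r.eval (t : ℂ)‖ ≤ ‖r.eval ((-1 : ℝ) : ℂ)‖ := by
  obtain ⟨n, rfl⟩ : ∃ n, N = n + 1 := ⟨N - 1, by omega⟩
  set K : ℂ := 2 * (U ℂ n).eval (-1) with hK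
  have hU1 : ‖(U ℂ n).eval (-1)‖ = n + 1 := by
    have h : (U ℝ n).eval (-1) = ((n : ℤ).negOnePow : ℤ) * ((n : ℝ) + 1) := by
      simpa using U_eval_neg_one (R := ℝ) (n : ℤ)
    have h' := complex_ofReal_eval_U (-1) (n : ℤ)
    rw [Complex.ofReal_neg, Complex.ofReal_one] at h'
    rw [← h', Complex.norm_real, h, Real.norm_eq_abs, abs_mul]
    have : |(((n : ℤ).negOnePow : ℤ) : ℝ)| = 1 := by
      rw [← Int.cast_abs]; simp
    rw [this, one_mul, abs_of_nonneg (by positivity)]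
  have hK0 : K ≠ 0 := by
    rw [← norm_ne_zero_iff, hK, norm_mul, hU1]
    simp; positivity
  have hlast : chebNode (n + 1) (n + 1) = -1 := by
    unfold chebNode
    rw [mul_comm, mul_div_assoc, div_self (by positivity), mul_one, Real.cos_pi]
  have heq : C K * r = C (r.eval (-1)) * ((1 - X) * U ℂ n) := by
    refine Polynomial.eq_of_degree_sub_lt_of_eval_finset_eq
      ((Finset.range (n + 1 + 1)).image (fun j : ℕ => ((chebNode (n + 1) j : ℝ) : ℂ))) ?_ ?_
    · rw [Finset.card_image_of_injOn (aux_node_inj (n + 1) hN), Finset.card_range]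
      refine lt_of_le_of_lt (b := ((n + 1 : ℕ) : WithBot ℕ)) ?_ (by exact_mod_cast Nat.lt_succ_self _)
      rw [← Polynomial.natDegree_le_iff_degree_le]
      have hd : (U ℂ n).natDegree = n := natDegree_U_natCast ℂ n
      have h1 : (1 - X : ℂ[X]).natDegree ≤ 1 := by compute_degree
      refine (Polynomial.natDegree_sub_le _ _).trans (max_le ?_ ?_)
      · exact (Polynomial.natDegree_C_mul_le _ _).trans hr
      · refine (Polynomial.natDegree_C_mul_le _ _).trans (Polynomial.natDegree_mul_le.trans ?_)
        omega
    · intro x hx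
      obtain ⟨j, hj, rfl⟩ := Finset.mem_image.mp hx
      have hj' : j < n + 1 + 1 := by simpa using hj
      rcases Nat.lt_succ_iff_lt_or_eq.mp hj' with hlt | rfl
      · simp only [eval_mul, eval_C, h0 j hlt, mul_zero, eval_sub, eval_one, eval_X]
        rcases Nat.eq_zero_or_pos j with rfl | hjp
        · simp [chebNode]
        · have hroot : (U ℝ n).eval (chebNode (n + 1) j) = 0 := by
            have hs := U_real_cos (j * Real.pi / ((n + 1 : ℕ) : ℝ)) (n : ℤ)
            have hz : ((((n : ℤ) : ℝ) + 1) * (j * Real.pi / ((n + 1 : ℕ) : ℝ))) = j * Real.pi := by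
              push_cast; field_simp
            rw [hz, Real.sin_nat_mul_pi] at hs
            refine (mul_eq_zero.mp hs).resolve_right (ne_of_gt ?_)
            apply Real.sin_pos_of_pos_of_lt_pi
            · positivity
            · rw [div_lt_iff₀ (by positivity)]
              have : (j : ℝ) < ((n + 1 : ℕ) : ℝ) := by exact_mod_cast hlt
              nlinarith [Real.pi_pos]
          rw [← complex_ofReal_eval_U, hroot]; simp
      · rw [hlast]
        simp [hK]; ring
  have ht' : |t| ≤ 1 := abs_le.mpr ht
  have hev := congrArg (fun f => ‖Polynomial.eval (t : ℂ) f‖) heq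
  simp only [eval_mul, eval_C, eval_sub, eval_one, eval_X, norm_mul] at hev
  have hb : ‖(U ℂ n).eval (t : ℂ)‖ ≤ n + 1 := by
    rw [← complex_ofReal_eval_U, Complex.norm_real]; exact aux_U_bound n t ht'
  have hb2 : ‖(1 : ℂ) - t‖ ≤ 2 := by
    rw [← Complex.ofReal_one, ← Complex.ofReal_sub, Complex.norm_real, Real.norm_eq_abs, abs_le]
    constructor <;> linarith [ht.1, ht.2]
  have hKn : ‖K‖ = 2 * (n + 1) := by rw [hK, norm_mul, hU1]; simp
  have hprod : ‖(1 : ℂ) - t‖ * ‖(U ℂ n).eval (t : ℂ)‖ ≤ 2 * (n + 1) :=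
    mul_le_mul hb2 hb (norm_nonneg _) (by norm_num)
  have hfin : ‖K‖ * ‖r.eval (t : ℂ)‖ ≤ ‖K‖ * ‖r.eval (-1)‖ := by
    rw [hev, hKn, mul_comm (2 * ((n : ℝ) + 1))]
    exact mul_le_mul_of_nonneg_left hprod (norm_nonneg _)
  have := le_of_mul_le_mul_left hfin (norm_pos_iff.mpr hK0)
  simpa using this

theorem aux_ode (a : ℝ → ℂ) (ha : ContinuousOn a (Icc (-1 : ℝ) 1)) (e g : ℝ → ℂ) (D : ℝ)
    (he : ∀ t ∈ Icc (-1 : ℝ) 1, HasDerivWithinAt e (a t * e t + g t) (Icc (-1 : ℝ) 1) t)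
    (he0 : e (-1) = 0) (hg : ∀ t ∈ Icc (-1 : ℝ) 1, ‖g t‖ ≤ D) (t : ℝ) (ht : t ∈ Icc (-1 : ℝ) 1) :
    ‖e t‖ ≤ 2 * Real.exp (∫ s in (-1 : ℝ)..1, max (a s).re 0) * D := by
  have h11 : (-1 : ℝ) ≤ 1 := by norm_num
  have hD : 0 ≤ D := (norm_nonneg _).trans (hg t ht)
  set b : ℝ → ℂ := IccExtend h11 ((Icc (-1 : ℝ) 1).domRestrict a) with hb
  have hbc : Continuous b := (continuousOn_iff_continuous_domRestrict.mp ha).Icc_extend'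
  have hba : ∀ s ∈ Icc (-1 : ℝ) 1, b s = a s := by
    intro s hs
    rw [hb, IccExtend_of_mem h11 _ hs]; rfl
  set A : ℝ → ℂ := fun s => ∫ x in (-1 : ℝ)..s, b x with hA
  have hAd : ∀ s, HasDerivAt A (b s) s := fun s => hbc.integral_hasStrictDerivAt (-1) s |>.hasDerivAt
  set m : ℝ → ℝ := fun s => max (b s).re 0 with hm
  have hmc : Continuous m := (Complex.continuous_re.comp hbc).max continuous_const
  have hint : ∫ s in (-1 : ℝ)..1, max (a s).re 0 = ∫ s in (-1 : ℝ)..1, m s := by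
    apply intervalIntegral.integral_congr
    intro s hs
    rw [uIcc_of_le h11] at hs
    simp [hm, hba s hs]
  rw [hint]
  have hexp : ∀ s ∈ Icc (-1 : ℝ) t, ‖Complex.exp (A t - A s)‖ ≤ Real.exp (∫ s in (-1 : ℝ)..1, m s) := by
    intro s hs
    rw [Complex.norm_exp]
    apply Real.exp_le_exp.mpr
    have h1 : A t - A s = ∫ x in s..t, b x :=
      intervalIntegral.integral_interval_sub_left (hbc.intervalIntegrable _ _) (hbc.intervalIntegrable _ _)
    have h2 : (∫ x in s..t, b x).re = ∫ x in s..t, (b x).re := by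
      have := Complex.reCLM.intervalIntegral_comp_comm (hbc.intervalIntegrable (μ := MeasureTheory.volume) s t)
      simpa using this.symm
    rw [h1, h2]
    calc ∫ x in s..t, (b x).re ≤ ∫ x in s..t, m x := by
          apply intervalIntegral.integral_mono_on hs.2
            ((Complex.continuous_re.comp hbc).intervalIntegrable _ _) (hmc.intervalIntegrable _ _)
          intro x _
          exact le_max_left _ _
      _ ≤ ∫ x in (-1 : ℝ)..1, m x := by
          apply intervalIntegral.integral_mono_interval hs.1 hs.2 ht.2
          · exact Filter.Eventually.of_forall fun x => le_max_right _ _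
          · exact hmc.intervalIntegrable _ _
  have hmv := norm_image_sub_le_of_norm_deriv_le_segment'
    (f := fun s => Complex.exp (A t - A s) * e s)
    (f' := fun s => Complex.exp (A t - A s) * g s)
    (C := Real.exp (∫ s in (-1 : ℝ)..1, m s) * D) (a := -1) (b := t) ?_ ?_ t ⟨ht.1, le_rfl⟩
  · simp only [he0, mul_zero, sub_zero, sub_self, Complex.exp_zero, one_mul] at hmv
    refine hmv.trans ?_
    have : 0 ≤ Real.exp (∫ s in (-1 : ℝ)..1, m s) * D := by positivity
    nlinarith [ht.2]
  · intro s hs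
    have hs' : s ∈ Icc (-1 : ℝ) 1 := ⟨hs.1, hs.2.trans ht.2⟩
    have h1 := (he s hs').mono (Icc_subset_Icc_right ht.2)
    have h2 := (((hAd s).const_sub (A t)).cexp).hasDerivWithinAt (s := Icc (-1) t)
    have h3 := h2.mul h1
    refine h3.congr_deriv ?_
    rw [hba s hs']; ring
  · intro s hs
    have hs' : s ∈ Icc (-1 : ℝ) 1 := ⟨hs.1, hs.2.le.trans ht.2⟩
    rw [norm_mul]
    exact mul_le_mul (hexp s ⟨hs.1, hs.2.le⟩) (hg s hs') (norm_nonneg _) (Real.exp_pos _).le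

theorem aux_le_supNorm (f : ℝ → ℂ) (hf : ContinuousOn f (Icc (-1 : ℝ) 1)) (t : ℝ)
    (ht : t ∈ Icc (-1 : ℝ) 1) : ‖f t‖ ≤ supNorm f := by
  have hb : BddAbove (Set.range fun t : Icc (-1 : ℝ) 1 => ‖f t‖) := by
    obtain ⟨M, hM⟩ := isCompact_Icc.exists_bound_of_continuousOn hf
    exact ⟨M, by rintro _ ⟨s, rfl⟩; exact hM s s.2⟩
  exact le_ciSup hb ⟨t, ht⟩

/-- a posteriori derivative estimate for the Chebyshev collocation
solution of a scalar linear ODE initial value problem.  Here `q` plays the role of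
`I_N(a·p)` and `w` the role of `I_N(u)` (the unique polynomials of degree `≤ N`
interpolating `a·p` resp. `u` at the `N+1` Chebyshev collocation points). -/
theorem apost_ivp_derivative
    (N : ℕ) (hN : 1 ≤ N)
    (a u : ℝ → ℂ)
    (ha : ContinuousOn a (Icc (-1 : ℝ) 1)) (hu : ContinuousOn u (Icc (-1 : ℝ) 1))
    (y0 : ℂ) (y y' : ℝ → ℂ)
    (hy : ∀ t ∈ Icc (-1 : ℝ) 1, HasDerivWithinAt y (y' t) (Icc (-1 : ℝ) 1) t)
    (hode : ∀ t ∈ Icc (-1 : ℝ) 1, y' t = a t * y t + u t)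
    (hy0 : y (-1) = y0)
    (p : Polynomial ℂ) (hpdeg : p.natDegree ≤ N)
    (hcolloc : ∀ j < N,
      (Polynomial.derivative p).eval ((chebNode N j : ℝ) : ℂ)
        = a (chebNode N j) * p.eval ((chebNode N j : ℝ) : ℂ) + u (chebNode N j))
    (hpinit : p.eval ((-1 : ℝ) : ℂ) = y0)
    (q : Polynomial ℂ) (hqdeg : q.natDegree ≤ N)
    (hq : ∀ j ≤ N, q.eval ((chebNode N j : ℝ) : ℂ)
        = a (chebNode N j) * p.eval ((chebNode N j : ℝ) : ℂ))
    (w : Polynomial ℂ) (hwdeg : w.natDegree ≤ N)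
    (hw : ∀ j ≤ N, w.eval ((chebNode N j : ℝ) : ℂ) = u (chebNode N j))
    (Ca : ℝ) (hCa : Ca = Real.exp (∫ s in (-1 : ℝ)..1, max (a s).re 0))
    (Rp : ℂ)
    (hRp : Rp = (Polynomial.derivative p).eval ((-1 : ℝ) : ℂ) - a (-1) * y0 - u (-1)) :
    supNorm (fun t => y' t - (Polynomial.derivative p).eval ((t : ℝ) : ℂ))
      ≤ (2 * Ca * supNorm a + 1)
        * (supNorm (fun t => a t * p.eval ((t : ℝ) : ℂ) - q.eval ((t : ℝ) : ℂ))
          + supNorm (fun t => u t - w.eval ((t : ℝ) : ℂ)) + ‖Rp‖) := by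
  have hpc : ∀ f : Polynomial ℂ, ContinuousOn (fun t : ℝ => f.eval ((t : ℝ) : ℂ)) (Icc (-1 : ℝ) 1) :=
    fun f => (f.continuous.comp Complex.continuous_ofReal).continuousOn
  set D1 := supNorm (fun t => a t * p.eval ((t : ℝ) : ℂ) - q.eval ((t : ℝ) : ℂ)) with hD1
  set D2 := supNorm (fun t => u t - w.eval ((t : ℝ) : ℂ)) with hD2
  have hlast : chebNode N N = -1 := by
    unfold chebNode
    have : (N : ℝ) ≠ 0 := by positivity
    rw [mul_comm, mul_div_assoc, div_self this, mul_one, Real.cos_pi]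
  set r : Polynomial ℂ := derivative p - q - w with hr
  have hrdeg : r.natDegree ≤ N := by
    refine (natDegree_sub_le _ _).trans (max_le ((natDegree_sub_le _ _).trans (max_le ?_ hqdeg)) hwdeg)
    exact (natDegree_derivative_le p).trans (by omega)
  have hr1 : r.eval ((-1 : ℝ) : ℂ) = Rp := by
    have h1 := hq N le_rfl
    have h2 := hw N le_rfl
    rw [hlast] at h1 h2
    rw [hr, eval_sub, eval_sub, h1, h2, hpinit, hRp]
  have hrb : ∀ t ∈ Icc (-1 : ℝ) 1, ‖r.eval (t : ℂ)‖ ≤ ‖Rp‖ := by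
    intro t ht
    rw [← hr1]
    refine aux_resid N hN r hrdeg ?_ t ht
    intro j hj
    rw [hr, eval_sub, eval_sub, hcolloc j hj, hq j hj.le, hw j hj.le]; ring
  set g : ℝ → ℂ := fun t => (a t * p.eval (t : ℂ) - q.eval (t : ℂ)) + (u t - w.eval (t : ℂ))
    - r.eval (t : ℂ) with hgdef
  have hg : ∀ t ∈ Icc (-1 : ℝ) 1, ‖g t‖ ≤ D1 + D2 + ‖Rp‖ := by
    intro t ht
    have h1 := aux_le_supNorm (fun t => a t * p.eval ((t : ℝ) : ℂ) - q.eval ((t : ℝ) : ℂ))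
      ((ha.mul (hpc p)).sub (hpc q)) t ht
    have h2 := aux_le_supNorm (fun t => u t - w.eval ((t : ℝ) : ℂ)) (hu.sub (hpc w)) t ht
    exact (norm_sub_le _ _).trans (add_le_add ((norm_add_le _ _).trans (add_le_add h1 h2)) (hrb t ht))
  have hid : ∀ t ∈ Icc (-1 : ℝ) 1, y' t - (derivative p).eval (t : ℂ)
      = a t * (y t - p.eval (t : ℂ)) + g t := by
    intro t ht
    simp only [hode t ht, hgdef, hr, eval_sub]; ring
  have hE := aux_ode a ha (fun t => y t - p.eval (t : ℂ)) g (D1 + D2 + ‖Rp‖)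
    (by
      intro t ht
      have h1 := (hy t ht).sub (p.hasDerivAt (t : ℂ)).comp_ofReal.hasDerivWithinAt
      exact h1.congr_deriv (hid t ht))
    (by simp only [hpinit, hy0, sub_self]) hg
  rw [← hCa] at hE
  have : Nonempty (Icc (-1 : ℝ) 1) := ⟨⟨0, by norm_num, by norm_num⟩⟩
  refine ciSup_le fun ⟨t, ht⟩ => ?_
  show ‖y' t - (derivative p).eval (t : ℂ)‖ ≤ _
  rw [hid t ht]
  have ha1 := aux_le_supNorm a ha t ht
  calc _ ≤ ‖a t‖ * ‖y t - p.eval (t : ℂ)‖ + ‖g t‖ := by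
        rw [← norm_mul]; exact norm_add_le _ _
    _ ≤ supNorm a * (2 * Ca * (D1 + D2 + ‖Rp‖)) + (D1 + D2 + ‖Rp‖) :=
        add_le_add (mul_le_mul ha1 (hE t ht) (norm_nonneg _) ((norm_nonneg _).trans ha1)) (hg t ht)
    _ = _ := by ring
end

section
/- Let a, b : [-1,1] → ℂ be continuous and let U be the associated monodromy operator. Set c_0 = ‖b‖_∞, c_1 = 2.3·(1 + ‖a‖_∞) + π·‖b‖_∞, and c_2 = π·√2·‖a‖_∞·‖b‖_∞. Then for every continuous f : [-1,1] → ℂ with ‖f‖_{H¹} < ∞, one has ‖U f‖_{H¹} ≤ (c_0 + c_1·C_a + c_2·C_a²)·‖f‖_{H¹}. -/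
open Set

/-- The fundamental solution `Φ_a(t) = exp(∫_{-1}^t a(s) ds)`. -/
noncomputable def Phi (a : ℝ → ℂ) (t : ℝ) : ℂ := Complex.exp (∫ s in (-1 : ℝ)..t, a s)

/-- The monodromy operator
`(U f)(t) = Φ_a(t)·[f(1) + ∫_{-1}^t Φ_a(s)⁻¹·b(s)·f(s) ds]`. -/
noncomputable def Uop (a b : ℝ → ℂ) (f : ℝ → ℂ) (t : ℝ) : ℂ :=
  Phi a t * (f 1 + ∫ s in (-1 : ℝ)..t, (Phi a s)⁻¹ * b s * f s)

/-- The normalized Chebyshev polynomials. -/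
noncomputable def That (k : ℕ) (t : ℝ) : ℝ :=
  if k = 0 then Real.sqrt (1 / Real.pi)
  else Real.sqrt (2 / Real.pi) * Real.cos (k * Real.arccos t)

/-- The Chebyshev expansion coefficients
`f̂_k = ∫_{-1}^1 T̂_k(t)·f(t)·(1−t²)^{-1/2} dt`. -/
noncomputable def chebCoeff (f : ℝ → ℂ) (k : ℕ) : ℂ :=
  ∫ t in (-1 : ℝ)..1, (That k t : ℂ) * f t * ((Real.sqrt (1 - t ^ 2) : ℝ) : ℂ)⁻¹

/-- The `H¹` norm `‖f‖_{H¹} = (Σ_k (1+k)²·|f̂_k|²)^{1/2}`. -/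
noncomputable def h1Norm (f : ℝ → ℂ) : ℝ :=
  Real.sqrt (∑' k : ℕ, ((1 : ℝ) + k) ^ 2 * ‖chebCoeff f k‖ ^ 2)

open MeasureTheory intervalIntegral

theorem cov_cos {E : Type*} [NormedAddCommGroup E] [NormedSpace ℝ E] (g : ℝ → E) :
    ∫ t in (-1 : ℝ)..1, g t = ∫ θ in (0 : ℝ)..Real.pi, Real.sin θ • g (Real.cos θ) := by
  have himg : Set.image Real.cos (Ioo 0 Real.pi) = Ioo (-1) 1 := by
    ext t
    constructor
    · rintro ⟨θ, ⟨h0, h1⟩, rfl⟩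
      constructor
      · have := Real.cos_lt_cos_of_nonneg_of_le_pi h0.le le_rfl h1
        simpa using this
      · have := Real.cos_lt_cos_of_nonneg_of_le_pi le_rfl h1.le h0
        simpa using this
    · rintro ⟨h0, h1⟩
      refine ⟨Real.arccos t, ⟨Real.arccos_pos.2 h1, ?_⟩, Real.cos_arccos h0.le h1.le⟩
      refine lt_of_le_of_ne (Real.arccos_le_pi t) fun h => ?_
      rw [Real.arccos_eq_pi] at h
      linarith
  rw [integral_of_le (by norm_num), integral_of_le Real.pi_pos.le, integral_Ioc_eq_integral_Ioo,
    integral_Ioc_eq_integral_Ioo, ← himg,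
    integral_image_eq_integral_abs_deriv_smul (f' := fun θ => -Real.sin θ) measurableSet_Ioo
      (fun x _ => (Real.hasDerivAt_cos x).hasDerivWithinAt)
      (Real.injOn_cos.mono Ioo_subset_Icc_self)]
  refine setIntegral_congr_fun measurableSet_Ioo fun θ hθ => ?_
  simp only [abs_neg, abs_of_pos (Real.sin_pos_of_mem_Ioo hθ)]

theorem fold_int {F : ℝ → ℂ} (hF : Continuous F) :
    ∫ θ in (-Real.pi)..Real.pi, F θ = ∫ θ in (0 : ℝ)..Real.pi, (F θ + F (-θ)) := by
  have hF2 : Continuous fun θ => F (-θ) := hF.comp continuous_neg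
  rw [← integral_add_adjacent_intervals (b := 0) (hF.intervalIntegrable _ _)
    (hF.intervalIntegrable _ _), intervalIntegral.integral_add (hF.intervalIntegrable _ _)
    (hF2.intervalIntegrable _ _), add_comm]
  congr 1
  have := intervalIntegral.integral_comp_neg (a := 0) (b := Real.pi) F
  rw [neg_zero] at this
  exact this.symm

theorem chebCoeff_eq (f : ℝ → ℂ) (k : ℕ) :
    chebCoeff f k = ∫ θ in (0 : ℝ)..Real.pi, (That k (Real.cos θ) : ℂ) * f (Real.cos θ) := by
  rw [chebCoeff, cov_cos]
  rw [integral_of_le Real.pi_pos.le, integral_of_le Real.pi_pos.le, integral_Ioc_eq_integral_Ioo,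
    integral_Ioc_eq_integral_Ioo]
  refine setIntegral_congr_fun measurableSet_Ioo fun θ hθ => ?_
  have hs := Real.sin_pos_of_mem_Ioo hθ
  have : Real.sqrt (1 - Real.cos θ ^ 2) = Real.sin θ := by
    rw [← Real.sin_sq, Real.sqrt_sq hs.le]
  simp only [this, Complex.real_smul]
  have h2 : (Real.sin θ : ℂ) ≠ 0 := by exact_mod_cast hs.ne'
  field_simp

theorem hpi : -Real.pi < Real.pi := by linarith [Real.pi_pos]

noncomputable def FC (F : ℝ → ℂ) (n : ℤ) : ℂ := fourierCoeffOn hpi F n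

theorem FC_cos {f : ℝ → ℂ} (hf : Continuous f) (n : ℤ) :
    FC (fun θ => f (Real.cos θ)) n =
      (1 / Real.pi : ℂ) * ∫ θ in (0 : ℝ)..Real.pi, (Real.cos (n * θ) : ℂ) * f (Real.cos θ) := by
  have key : ∀ θ : ℝ, (fourier (-n) (θ : AddCircle (Real.pi - -Real.pi)) : ℂ) =
      Complex.exp (-(n * θ * Complex.I)) := by
    intro θ
    rw [fourier_coe_apply]
    congr 1
    have : (Real.pi : ℂ) ≠ 0 := by exact_mod_cast Real.pi_ne_zero
    push_cast
    field_simp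
    ring
  rw [FC, fourierCoeffOn_eq_integral]
  simp only [key, smul_eq_mul]
  rw [fold_int (by fun_prop)]
  have : ∀ θ : ℝ, Complex.exp (-(n * θ * Complex.I)) * f (Real.cos θ) +
      Complex.exp (-(n * (-θ : ℝ) * Complex.I)) * f (Real.cos (-θ)) =
      2 * ((Real.cos (n * θ) : ℂ) * f (Real.cos θ)) := by
    intro θ
    rw [Real.cos_neg]
    push_cast
    rw [Complex.cos]
    ring_nf
  simp only [this]
  rw [intervalIntegral.integral_const_mul, Complex.real_smul]
  push_cast
  ring

theorem norm_cheb_zero {f : ℝ → ℂ} (hf : Continuous f) :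
    ‖chebCoeff f 0‖ ^ 2 = Real.pi * ‖FC (fun θ => f (Real.cos θ)) 0‖ ^ 2 := by
  have hp := Real.pi_pos
  rw [chebCoeff_eq, FC_cos hf]
  simp only [That, if_true, intervalIntegral.integral_const_mul]
  simp only [Int.cast_zero, zero_mul, Real.cos_zero, Complex.ofReal_one, one_mul, norm_mul, mul_pow]
  rw [Complex.norm_real, Real.norm_eq_abs, sq_abs, Real.sq_sqrt (by positivity)]
  simp [abs_of_pos hp]
  field_simp

theorem norm_cheb_succ {f : ℝ → ℂ} (hf : Continuous f) (k : ℕ) (hk : k ≠ 0) :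
    ‖chebCoeff f k‖ ^ 2 = 2 * Real.pi * ‖FC (fun θ => f (Real.cos θ)) k‖ ^ 2 := by
  have hp := Real.pi_pos
  rw [chebCoeff_eq, FC_cos hf]
  have : ∫ θ in (0 : ℝ)..Real.pi, (That k (Real.cos θ) : ℂ) * f (Real.cos θ) =
      (Real.sqrt (2 / Real.pi) : ℂ) *
      ∫ θ in (0 : ℝ)..Real.pi, (Real.cos (((k : ℤ) : ℝ) * θ) : ℂ) * f (Real.cos θ) := by
    rw [← intervalIntegral.integral_const_mul]
    refine intervalIntegral.integral_congr fun θ hθ => ?_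
    rw [uIcc_of_le hp.le] at hθ
    simp only [That, hk, if_false, Real.arccos_cos hθ.1 hθ.2]
    push_cast
    ring
  rw [this]
  simp only [norm_mul, mul_pow]
  rw [Complex.norm_real, Real.norm_eq_abs, sq_abs, Real.sq_sqrt (by positivity)]
  simp [abs_of_pos hp]
  field_simp

theorem FC_neg {f : ℝ → ℂ} (hf : Continuous f) (n : ℤ) :
    FC (fun θ => f (Real.cos θ)) (-n) = FC (fun θ => f (Real.cos θ)) n := by
  rw [FC_cos hf, FC_cos hf]
  simp [neg_mul]

theorem hasSum_fold {h : ℤ → ℝ} (he : ∀ n, h (-n) = h n) {u : ℕ → ℝ}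
    (h0 : u 0 = Real.pi * h 0) (h1 : ∀ k : ℕ, k ≠ 0 → u k = 2 * Real.pi * h k) {s : ℝ}
    (hs : HasSum h s) : HasSum u (Real.pi * s) := by
  have := (hs.nat_add_neg.mul_left Real.pi).sub (hasSum_ite_eq (0 : ℕ) (Real.pi * h 0))
  have e1 : Real.pi * s = Real.pi * (s + h 0) - Real.pi * h 0 := by ring
  rw [e1]
  refine this.congr_fun ?_
  intro k
  by_cases hk : k = 0
  · subst hk; simp [h0]; ring
  · simp [hk, h1, he]; ring

theorem summable_unfold {h : ℤ → ℝ} (he : ∀ n, h (-n) = h n) {u : ℕ → ℝ}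
    (h0 : u 0 = Real.pi * h 0) (h1 : ∀ k : ℕ, k ≠ 0 → u k = 2 * Real.pi * h k)
    (hs : Summable u) : Summable h := by
  have hp := Real.pi_pos
  have h2 : Summable (fun k : ℕ => h k) := by
    have := (hs.mul_left (2 * Real.pi)⁻¹).add (hasSum_ite_eq (0 : ℕ) (h 0 / 2)).summable
    refine this.congr fun k => ?_
    by_cases hk : k = 0
    · subst hk; simp [h0]; field_simp; ring
    · simp [hk, h1]; field_simp
  exact Summable.of_nat_of_neg h2 (by simpa [he] using h2)

theorem hasSum_h1 {f : ℝ → ℂ} (hf : Continuous f) {s : ℝ}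
    (hs : HasSum (fun n : ℤ => (1 + |(n : ℝ)|) ^ 2 * ‖FC (fun θ => f (Real.cos θ)) n‖ ^ 2) s) :
    HasSum (fun k : ℕ => ((1 : ℝ) + k) ^ 2 * ‖chebCoeff f k‖ ^ 2) (Real.pi * s) := by
  refine hasSum_fold (fun n => ?_) ?_ (fun k hk => ?_) hs
  · simp [FC_neg hf]
  · simp [norm_cheb_zero hf]
  · simp [norm_cheb_succ hf k hk]; ring

theorem summable_h1 {f : ℝ → ℂ} (hf : Continuous f)
    (hs : Summable (fun k : ℕ => ((1 : ℝ) + k) ^ 2 * ‖chebCoeff f k‖ ^ 2)) :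
    Summable (fun n : ℤ => (1 + |(n : ℝ)|) ^ 2 * ‖FC (fun θ => f (Real.cos θ)) n‖ ^ 2) := by
  refine summable_unfold (fun n => ?_) ?_ (fun k hk => ?_) hs
  · simp [FC_neg hf]
  · simp [norm_cheb_zero hf]
  · simp [norm_cheb_succ hf k hk]; ring

theorem minkowski_aux {S P Q p q : ℝ} (hp : 0 ≤ p) (hq : 0 ≤ q) (hP : P ≤ p ^ 2) (hQ : Q ≤ q ^ 2)
    (h : ∀ l : ℝ, 0 < l → S ≤ (1 + l) * P + (1 + l⁻¹) * Q) : S ≤ (p + q) ^ 2 := by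
  have h1 : ∀ e : ℝ, 0 < e → S ≤ (p + e + (q + e)) ^ 2 := by
    intro e he
    have hpe : 0 < p + e := by linarith
    have hqe : 0 < q + e := by linarith
    have := h ((q + e) / (p + e)) (by positivity)
    have hP' : P ≤ (p + e) ^ 2 := by nlinarith
    have hQ' : Q ≤ (q + e) ^ 2 := by nlinarith
    calc S ≤ _ := this
      _ ≤ (1 + (q + e) / (p + e)) * (p + e) ^ 2 + (1 + ((q + e) / (p + e))⁻¹) * (q + e) ^ 2 := by
        gcongr
      _ = _ := by field_simp; ring
  have ht : Filter.Tendsto (fun e : ℝ => (p + e + (q + e)) ^ 2) (nhdsWithin 0 (Ioi 0))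
      (nhds ((p + 0 + (q + 0)) ^ 2)) := by
    apply Filter.Tendsto.mono_left _ nhdsWithin_le_nhds
    exact Continuous.tendsto (by fun_prop) 0
  have := ge_of_tendsto ht (Filter.eventually_of_mem self_mem_nhdsWithin fun e he => h1 e he)
  simpa using this

theorem cs_aux {x P Q p q : ℝ} (hp : 0 ≤ p) (hq : 0 ≤ q) (hP : P ≤ p ^ 2) (hQ : Q ≤ q ^ 2)
    (h : ∀ l : ℝ, 0 < l → 2 * x ≤ l * P + l⁻¹ * Q) : x ≤ p * q := by
  have := minkowski_aux (S := 2 * x + p ^ 2 + q ^ 2) hp hq le_rfl le_rfl (fun l hl => by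
    have := h l hl
    have h2 : l * P ≤ l * p ^ 2 := by gcongr
    have h3 : l⁻¹ * Q ≤ l⁻¹ * q ^ 2 := by gcongr
    linarith)
  nlinarith

theorem parseval {F : ℝ → ℂ} (hF : Continuous F) :
    HasSum (fun n : ℤ => ‖FC F n‖ ^ 2)
      ((2 * Real.pi)⁻¹ * ∫ θ in (-Real.pi)..Real.pi, ‖F θ‖ ^ 2) := by
  have hm : MemLp F 2 (volume.restrict (Ioc (-Real.pi) Real.pi)) := by
    rw [memLp_two_iff_integrable_sq_norm hF.aestronglyMeasurable]
    have : Continuous fun θ => ‖F θ‖ ^ 2 := by fun_prop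
    exact (this.integrableOn_Icc (a := -Real.pi) (b := Real.pi)).mono_set Ioc_subset_Icc_self
  have := hasSum_sq_fourierCoeffOn hpi hm
  rw [smul_eq_mul, show Real.pi - -Real.pi = 2 * Real.pi by ring] at this
  exact this

theorem mul_FC_deriv {G G' : ℝ → ℂ} (hG : ∀ θ, HasDerivAt G (G' θ) θ) (hG' : Continuous G')
    (hper : G Real.pi = G (-Real.pi)) (n : ℤ) :
    (n : ℝ) ^ 2 * ‖FC G n‖ ^ 2 ≤ ‖FC G' n‖ ^ 2 := by
  by_cases hn : n = 0
  · subst hn; simp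
  have := fourierCoeffOn_of_hasDerivAt hpi hn (fun x _ => hG x) (hG'.intervalIntegrable _ _)
  rw [hper, sub_self, mul_zero, zero_sub] at this
  have hp : (Real.pi : ℂ) ≠ 0 := by exact_mod_cast Real.pi_ne_zero
  have hn' : (n : ℂ) ≠ 0 := by exact_mod_cast hn
  have h2 : Complex.I * (n : ℂ) * FC G n = FC G' n := by
    rw [FC, this, FC]
    push_cast
    have hI := Complex.I_ne_zero
    field_simp
    ring
  rw [← h2, norm_mul, norm_mul, Complex.norm_I, one_mul, mul_pow, Complex.norm_intCast, sq_abs]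

theorem FC_eval_zero {F : ℝ → ℂ} (hF : Continuous F) (hper : F (-Real.pi) = F Real.pi)
    (hs : Summable (FC F)) : HasSum (FC F) (F 0) := by
  have : Fact (0 < Real.pi - -Real.pi) := ⟨by linarith [Real.pi_pos]⟩
  have hc : Continuous (AddCircle.liftIoc (Real.pi - -Real.pi) (-Real.pi) F) :=
    AddCircle.liftIoc_continuous (by rw [hper]; congr 1; ring) hF.continuousOn
  have := has_pointwise_sum_fourier_series_of_summable
    (f := (⟨_, hc⟩ : C(AddCircle (Real.pi - -Real.pi), ℂ))) hs ((0 : ℝ) : AddCircle (Real.pi - -Real.pi))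
  simp only [ContinuousMap.coe_mk] at this
  rw [AddCircle.liftIoc_coe_apply (by constructor <;> linarith [Real.pi_pos])] at this
  simp only [QuotientAddGroup.mk_zero, fourier_eval_zero, smul_eq_mul, mul_one] at this
  exact this

theorem hasSum_Z : HasSum (fun n : ℤ => ((1 + |(n : ℝ)|) ^ 2)⁻¹) (Real.pi ^ 2 / 3 - 1) := by
  have h0 : HasSum (fun n : ℕ => ((1 + (n : ℝ)) ^ 2)⁻¹) (Real.pi ^ 2 / 6) := by
    have := (hasSum_nat_add_iff' 1).2 hasSum_zeta_two
    simp at this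
    refine this.congr_fun fun n => ?_
    rw [add_comm]
  have := HasSum.of_nat_of_neg (f := fun n : ℤ => ((1 + |(n : ℝ)|) ^ 2)⁻¹)
    (by simpa using h0) (by simpa using h0)
  convert! this using 1
  simp
  ring

theorem eval_one_bound {f : ℝ → ℂ} (hf : Continuous f) {H h : ℝ} (hh : 0 ≤ h) (hH : H ≤ h ^ 2)
    (hs : HasSum (fun n : ℤ => (1 + |(n : ℝ)|) ^ 2 * ‖FC (fun θ => f (Real.cos θ)) n‖ ^ 2) H) :
    ‖f 1‖ ≤ 2 * h := by
  set c := FC (fun θ => f (Real.cos θ)) with hc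
  have hle : ∀ l : ℝ, 0 < l → ∀ n : ℤ, 2 * ‖c n‖ ≤ l * ((1 + |(n : ℝ)|) ^ 2)⁻¹ +
      l⁻¹ * ((1 + |(n : ℝ)|) ^ 2 * ‖c n‖ ^ 2) := by
    intro l hl n
    have hw : 0 < 1 + |(n : ℝ)| := by positivity
    set w := 1 + |(n : ℝ)|
    have : l * (w ^ 2)⁻¹ + l⁻¹ * (w ^ 2 * ‖c n‖ ^ 2) - 2 * ‖c n‖ =
      l * (w⁻¹ - l⁻¹ * w * ‖c n‖) ^ 2 := by field_simp; ring
    have h3 : 0 ≤ l * (w⁻¹ - l⁻¹ * w * ‖c n‖) ^ 2 := by positivity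
    linarith
  have hsum : Summable (fun n => ‖c n‖) := by
    have h1 : Summable (fun n => 2 * ‖c n‖) :=
      Summable.of_nonneg_of_le (fun n => by positivity) (hle 1 one_pos)
        ((hasSum_Z.mul_left 1).add (hs.mul_left (1 : ℝ)⁻¹)).summable
    exact (summable_mul_left_iff (by norm_num)).1 h1
  have h0 := FC_eval_zero (F := fun θ => f (Real.cos θ)) (by fun_prop) (by simp) hsum.of_norm
  simp only [Real.cos_zero] at h0
  have h1 : ‖f 1‖ ≤ ∑' n, ‖c n‖ := by
    rw [← h0.tsum_eq]
    exact norm_tsum_le_tsum_norm hsum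
  refine h1.trans (cs_aux (P := Real.pi ^ 2 / 3 - 1) (by norm_num) hh ?_ hH fun l hl => ?_)
  · nlinarith [Real.pi_lt_d2, Real.pi_pos]
  · rw [← tsum_mul_left]
    exact hasSum_le (hle l hl) (hsum.mul_left 2).hasSum ((hasSum_Z.mul_left l).add (hs.mul_left l⁻¹))

theorem l1_bound {f : ℝ → ℂ} (hf : Continuous f) {q : ℝ} (hq : 0 ≤ q)
    (hQ : (2 * Real.pi)⁻¹ * ∫ θ in (-Real.pi)..Real.pi, ‖f (Real.cos θ)‖ ^ 2 ≤ q ^ 2) :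
    ∫ t in (-1 : ℝ)..1, ‖f t‖ ≤ Real.pi * q := by
  have hp := Real.pi_pos
  have hfold : ∫ θ in (-Real.pi)..Real.pi, ‖f (Real.cos θ)‖ ^ 2 =
      2 * ∫ θ in (0 : ℝ)..Real.pi, ‖f (Real.cos θ)‖ ^ 2 := by
    have hc : Continuous fun θ => ‖f (Real.cos θ)‖ ^ 2 := by fun_prop
    have := intervalIntegral.integral_comp_neg (a := 0) (b := Real.pi)
      (fun θ => ‖f (Real.cos θ)‖ ^ 2)
    simp only [Real.cos_neg, neg_zero] at this
    rw [← integral_add_adjacent_intervals (b := 0) (hc.intervalIntegrable _ _)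
      (hc.intervalIntegrable _ _), ← this]
    ring
  rw [hfold] at hQ
  have h1 : ∫ t in (-1 : ℝ)..1, ‖f t‖ ≤ ∫ θ in (0 : ℝ)..Real.pi, ‖f (Real.cos θ)‖ := by
    rw [cov_cos]
    refine intervalIntegral.integral_mono_on hp.le (Continuous.intervalIntegrable (by fun_prop) _ _)
      (Continuous.intervalIntegrable (by fun_prop) _ _) fun θ _ => ?_
    rw [smul_eq_mul]
    exact mul_le_of_le_one_left (norm_nonneg _) (Real.sin_le_one θ)
  refine h1.trans (cs_aux (P := Real.pi ^ 2) (Q := (Real.pi)⁻¹ * ∫ θ in (0 : ℝ)..Real.pi, ‖f (Real.cos θ)‖ ^ 2)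
    hp.le hq le_rfl ?_ ?_)
  · refine le_of_eq_of_le ?_ hQ
    field_simp
  · intro l hl
    have : ∫ θ in (0 : ℝ)..Real.pi, 2 * ‖f (Real.cos θ)‖ ≤
        ∫ θ in (0 : ℝ)..Real.pi, (l * Real.pi + l⁻¹ * Real.pi⁻¹ * ‖f (Real.cos θ)‖ ^ 2) := by
      refine intervalIntegral.integral_mono_on hp.le
        (Continuous.intervalIntegrable (by fun_prop) _ _)
        (Continuous.intervalIntegrable (by fun_prop) _ _) fun θ _ => ?_
      set x := ‖f (Real.cos θ)‖
      have e : l * Real.pi + l⁻¹ * Real.pi⁻¹ * x ^ 2 - 2 * x =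
        l * Real.pi * (1 - l⁻¹ * Real.pi⁻¹ * x) ^ 2 := by field_simp; ring
      have h3 : 0 ≤ l * Real.pi * (1 - l⁻¹ * Real.pi⁻¹ * x) ^ 2 := by positivity
      linarith
    rw [intervalIntegral.integral_const_mul, intervalIntegral.integral_add
      (Continuous.intervalIntegrable (by fun_prop) _ _)
      (Continuous.intervalIntegrable (by fun_prop) _ _),
      intervalIntegral.integral_const_mul (l⁻¹ * Real.pi⁻¹),
      intervalIntegral.integral_const, smul_eq_mul] at this
    linarith

theorem Phi_hasDerivAt {a : ℝ → ℂ} (ha : Continuous a) (t : ℝ) :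
    HasDerivAt (Phi a) (a t * Phi a t) t := by
  have := (ha.integral_hasStrictDerivAt (-1) t).hasDerivAt.cexp
  rw [mul_comm] at this
  exact this

theorem Phi_ne (a : ℝ → ℂ) (t : ℝ) : Phi a t ≠ 0 := Complex.exp_ne_zero _

theorem Phi_continuous {a : ℝ → ℂ} (ha : Continuous a) : Continuous (Phi a) :=
  continuous_iff_continuousAt.2 fun t => (Phi_hasDerivAt ha t).continuousAt

theorem integrand_continuous {a b f : ℝ → ℂ} (ha : Continuous a) (hb : Continuous b)
    (hf : Continuous f) : Continuous fun s => (Phi a s)⁻¹ * b s * f s :=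
  (((Phi_continuous ha).inv₀ (Phi_ne a)).mul hb).mul hf

theorem Uop_hasDerivAt {a b f : ℝ → ℂ} (ha : Continuous a) (hb : Continuous b)
    (hf : Continuous f) (t : ℝ) :
    HasDerivAt (Uop a b f) (a t * Uop a b f t + b t * f t) t := by
  have h1 := ((integrand_continuous ha hb hf).integral_hasStrictDerivAt (-1) t).hasDerivAt
  have h2 := (Phi_hasDerivAt ha t).mul (h1.const_add (f 1))
  refine (h2.congr_deriv ?_ : HasDerivAt (Uop a b f) _ t)
  have := Phi_ne a t
  rw [Uop]
  field_simp

theorem Phi_ratio {a : ℝ → ℂ} (ha : Continuous a) {s t : ℝ} (hs : -1 ≤ s) (hst : s ≤ t)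
    (ht : t ≤ 1) :
    ‖Phi a t * (Phi a s)⁻¹‖ ≤ Real.exp (∫ s in (-1 : ℝ)..1, max (a s).re 0) := by
  have hm : Continuous fun s => max (a s).re 0 := by fun_prop
  rw [Phi, Phi, ← Complex.exp_neg, ← Complex.exp_add, Complex.norm_exp, Real.exp_le_exp,
    ← sub_eq_add_neg, integral_interval_sub_left (ha.intervalIntegrable _ _)
      (ha.intervalIntegrable _ _)]
  have hre : (∫ x in s..t, a x).re = ∫ x in s..t, (a x).re :=
    (Complex.reCLM.intervalIntegral_comp_comm (ha.intervalIntegrable _ _)).symm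
  rw [hre]
  calc ∫ x in s..t, (a x).re ≤ ∫ x in s..t, max (a x).re 0 :=
        intervalIntegral.integral_mono_on hst (Continuous.intervalIntegrable (by fun_prop) _ _)
          (hm.intervalIntegrable _ _) fun x _ => le_max_left _ _
    _ ≤ _ := intervalIntegral.integral_mono_interval hs hst ht
          (Filter.Eventually.of_forall fun x => le_max_right _ _) (hm.intervalIntegrable _ _)

theorem Uop_bound {a b f : ℝ → ℂ} (ha : Continuous a) (hb : Continuous b)
    (hf : Continuous f) {B : ℝ} (hB : ∀ t ∈ Icc (-1 : ℝ) 1, ‖b t‖ ≤ B) (t : ℝ)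
    (ht : t ∈ Icc (-1 : ℝ) 1) :
    ‖Uop a b f t‖ ≤ Real.exp (∫ s in (-1 : ℝ)..1, max (a s).re 0) *
      (‖f 1‖ + B * ∫ s in (-1 : ℝ)..1, ‖f s‖) := by
  set C := Real.exp (∫ s in (-1 : ℝ)..1, max (a s).re 0) with hC
  have hB0 : 0 ≤ B := (norm_nonneg _).trans (hB t ht)
  have hC0 : 0 < C := Real.exp_pos _
  have hP : ‖Phi a t‖ ≤ C := by
    have := Phi_ratio ha le_rfl ht.1 ht.2
    simpa [Phi] using this
  rw [Uop, mul_add, mul_add]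
  refine (norm_add_le _ _).trans (add_le_add ?_ ?_)
  · rw [norm_mul]; gcongr
  · rw [← intervalIntegral.integral_const_mul]
    have hcn : Continuous fun s => C * (B * ‖f s‖) := by fun_prop
    calc ‖∫ s in (-1 : ℝ)..t, Phi a t * ((Phi a s)⁻¹ * b s * f s)‖
        ≤ ∫ s in (-1 : ℝ)..t, C * (B * ‖f s‖) := by
          refine intervalIntegral.norm_integral_le_of_norm_le ht.1 ?_ (hcn.intervalIntegrable _ _)
          refine Filter.Eventually.of_forall fun s hs => ?_
          have h1 := Phi_ratio ha hs.1.le hs.2 ht.2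
          have h2 := hB s ⟨hs.1.le, hs.2.trans ht.2⟩
          rw [← mul_assoc, ← mul_assoc, norm_mul, norm_mul, mul_assoc]
          gcongr
      _ ≤ ∫ s in (-1 : ℝ)..1, C * (B * ‖f s‖) :=
          intervalIntegral.integral_mono_interval le_rfl ht.1 ht.2
            (Filter.Eventually.of_forall fun x => by positivity) (hcn.intervalIntegrable _ _)
      _ = _ := by rw [intervalIntegral.integral_const_mul, intervalIntegral.integral_const_mul]

theorem main_cont {a b f : ℝ → ℂ} (ha : Continuous a) (hb : Continuous b) (hf : Continuous f)
    {A B C : ℝ} (hA : ∀ t ∈ Icc (-1 : ℝ) 1, ‖a t‖ ≤ A) (hB : ∀ t ∈ Icc (-1 : ℝ) 1, ‖b t‖ ≤ B)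
    (hC : C = Real.exp (∫ s in (-1 : ℝ)..1, max (a s).re 0))
    (hs : Summable (fun k : ℕ => ((1 : ℝ) + k) ^ 2 * ‖chebCoeff f k‖ ^ 2)) :
    Summable (fun k : ℕ => ((1 : ℝ) + k) ^ 2 * ‖chebCoeff (Uop a b f) k‖ ^ 2)
      ∧ h1Norm (Uop a b f) ≤
        (B + (2 * (1 + A) + Real.pi * B) * C + Real.pi * A * B * C) * h1Norm f := by
  have hp := Real.pi_pos
  have hA0 : 0 ≤ A := (norm_nonneg _).trans (hA 0 (by norm_num))
  have hB0 : 0 ≤ B := (norm_nonneg _).trans (hB 0 (by norm_num))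
  have hC0 : 0 < C := hC ▸ Real.exp_pos _
  have hcos : ∀ θ, Real.cos θ ∈ Icc (-1 : ℝ) 1 := Real.cos_mem_Icc
  set N := h1Norm f with hN
  have hN0 : 0 ≤ N := Real.sqrt_nonneg _
  have hsp : 0 < Real.sqrt Real.pi := Real.sqrt_pos.2 hp
  have hsp2 : Real.sqrt Real.pi ^ 2 = Real.pi := Real.sq_sqrt hp.le
  -- the coefficients of `f`
  obtain ⟨H, hH⟩ := summable_h1 hf hs
  have hH2 : N ^ 2 = Real.pi * H := by
    rw [hN, h1Norm, (hasSum_h1 hf hH).tsum_eq, Real.sq_sqrt]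
    exact mul_nonneg hp.le (hH.nonneg fun n => by positivity)
  set q := N / Real.sqrt Real.pi with hq
  have hq0 : 0 ≤ q := by positivity
  have hHq : H = q ^ 2 := by
    rw [hq, div_pow, hsp2, hH2]; field_simp
  have hf1 : ‖f 1‖ ≤ 2 * q := eval_one_bound hf hq0 hHq.le hH
  have hL2 : (2 * Real.pi)⁻¹ * ∫ θ in (-Real.pi)..Real.pi, ‖f (Real.cos θ)‖ ^ 2 ≤ q ^ 2 := by
    rw [← hHq]
    refine hasSum_le (fun n => ?_) (parseval (F := fun θ => f (Real.cos θ)) (by fun_prop)) hH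
    refine le_mul_of_one_le_left (by positivity) ?_
    exact one_le_pow₀ (by linarith [abs_nonneg (n : ℝ)])
  have hL1 := l1_bound hf hq0 hL2
  -- the sup bound
  set M := C * (2 * q + B * (Real.pi * q)) with hM
  have hM0 : 0 ≤ M := by positivity
  have hsup : ∀ θ, ‖Uop a b f (Real.cos θ)‖ ≤ M := by
    intro θ
    refine (Uop_bound ha hb hf hB _ (hcos θ)).trans ?_
    rw [← hC, hM]
    gcongr
  have hU : Continuous (Uop a b f) :=
    continuous_iff_continuousAt.2 fun t => (Uop_hasDerivAt ha hb hf t).continuousAt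
  set G : ℝ → ℂ := fun θ => Uop a b f (Real.cos θ) with hG
  set G' : ℝ → ℂ := fun θ => (-Real.sin θ : ℝ) •
    (a (Real.cos θ) * Uop a b f (Real.cos θ) + b (Real.cos θ) * f (Real.cos θ)) with hG'
  have hGc : Continuous G := by fun_prop
  have hGc' : Continuous G' := by fun_prop
  have hder : ∀ θ, HasDerivAt G (G' θ) θ := fun θ =>
    HasDerivAt.scomp θ (Uop_hasDerivAt ha hb hf _) (Real.hasDerivAt_cos θ)
  have hP := parseval hGc
  have hQ := parseval hGc'
  have hPle : (2 * Real.pi)⁻¹ * ∫ θ in (-Real.pi)..Real.pi, ‖G θ‖ ^ 2 ≤ M ^ 2 := by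
    have : ∫ θ in (-Real.pi)..Real.pi, ‖G θ‖ ^ 2 ≤ ∫ θ in (-Real.pi)..Real.pi, M ^ 2 := by
      refine intervalIntegral.integral_mono_on hpi.le
        (Continuous.intervalIntegrable (by fun_prop) _ _)
        (Continuous.intervalIntegrable (by fun_prop) _ _) fun θ _ => ?_
      have := hsup θ
      gcongr
    rw [intervalIntegral.integral_const, smul_eq_mul] at this
    rw [inv_mul_le_iff₀ (by positivity)]
    linarith
  have hG'le : ∀ θ, ‖G' θ‖ ≤ A * M + B * ‖f (Real.cos θ)‖ := by
    intro θ
    have h1 : ‖a (Real.cos θ) * Uop a b f (Real.cos θ) + b (Real.cos θ) * f (Real.cos θ)‖ ≤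
        A * M + B * ‖f (Real.cos θ)‖ := by
      refine (norm_add_le _ _).trans ?_
      rw [norm_mul, norm_mul]
      have := hA _ (hcos θ)
      have := hB _ (hcos θ)
      have := hsup θ
      gcongr
    rw [hG', norm_smul, Real.norm_eq_abs, abs_neg]
    exact (mul_le_of_le_one_left (norm_nonneg _) (Real.abs_sin_le_one θ)).trans h1
  have hQle : (2 * Real.pi)⁻¹ * ∫ θ in (-Real.pi)..Real.pi, ‖G' θ‖ ^ 2 ≤ (A * M + B * q) ^ 2 := by
    refine minkowski_aux (P := (A * M) ^ 2) (Q := B ^ 2 * ((2 * Real.pi)⁻¹ *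
      ∫ θ in (-Real.pi)..Real.pi, ‖f (Real.cos θ)‖ ^ 2)) (by positivity) (by positivity) le_rfl
      (by rw [mul_pow]; gcongr) fun l hl => ?_
    have : ∫ θ in (-Real.pi)..Real.pi, ‖G' θ‖ ^ 2 ≤ ∫ θ in (-Real.pi)..Real.pi,
        ((1 + l) * (A * M) ^ 2 + ((1 + l⁻¹) * B ^ 2) * ‖f (Real.cos θ)‖ ^ 2) := by
      refine intervalIntegral.integral_mono_on hpi.le
        (Continuous.intervalIntegrable (by fun_prop) _ _)
        (Continuous.intervalIntegrable (by fun_prop) _ _) fun θ _ => ?_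
      have h1 : ‖G' θ‖ ^ 2 ≤ (A * M + B * ‖f (Real.cos θ)‖) ^ 2 := by
        have := hG'le θ
        gcongr
      refine h1.trans ?_
      set x := A * M
      set y := ‖f (Real.cos θ)‖
      have e : (1 + l) * x ^ 2 + (1 + l⁻¹) * B ^ 2 * y ^ 2 - (x + B * y) ^ 2 =
        l * (x - l⁻¹ * (B * y)) ^ 2 := by field_simp; ring
      have h3 : 0 ≤ l * (x - l⁻¹ * (B * y)) ^ 2 := by positivity
      linarith
    rw [intervalIntegral.integral_add
      (Continuous.intervalIntegrable (by fun_prop) _ _)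
      (Continuous.intervalIntegrable (by fun_prop) _ _),
      intervalIntegral.integral_const_mul ((1 + l⁻¹) * B ^ 2),
      intervalIntegral.integral_const, smul_eq_mul] at this
    rw [inv_mul_le_iff₀ (by positivity)]
    refine this.trans (le_of_eq ?_)
    field_simp
    ring
  -- combine
  have hn2 : ∀ n : ℤ, (n : ℝ) ^ 2 * ‖FC G n‖ ^ 2 ≤ ‖FC G' n‖ ^ 2 :=
    mul_FC_deriv hder hGc' (by simp [hG])
  have hpt : ∀ l : ℝ, 0 < l → ∀ n : ℤ, (1 + |(n : ℝ)|) ^ 2 * ‖FC G n‖ ^ 2 ≤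
      (1 + l) * ‖FC G n‖ ^ 2 + (1 + l⁻¹) * ‖FC G' n‖ ^ 2 := by
    intro l hl n
    have h1 : (1 + l⁻¹) * ((n : ℝ) ^ 2 * ‖FC G n‖ ^ 2) ≤ (1 + l⁻¹) * ‖FC G' n‖ ^ 2 := by
      have := hn2 n
      gcongr
    rw [← sq_abs (n : ℝ)] at h1
    set w := |(n : ℝ)|
    set x := ‖FC G n‖
    have e : (1 + l) * x ^ 2 + (1 + l⁻¹) * (w ^ 2 * x ^ 2) - (1 + w) ^ 2 * x ^ 2 =
      l * (x - l⁻¹ * (w * x)) ^ 2 := by field_simp; ring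
    have h3 : 0 ≤ l * (x - l⁻¹ * (w * x)) ^ 2 := by positivity
    linarith
  have hsumG : Summable (fun n : ℤ => (1 + |(n : ℝ)|) ^ 2 * ‖FC G n‖ ^ 2) :=
    Summable.of_nonneg_of_le (fun n => by positivity) (hpt 1 one_pos)
      ((hP.mul_left _).add (hQ.mul_left _)).summable
  obtain ⟨S, hS⟩ := hsumG
  have hSle : S ≤ (M + (A * M + B * q)) ^ 2 :=
    minkowski_aux hM0 (by positivity) hPle hQle fun l hl =>
      hasSum_le (hpt l hl) hS ((hP.mul_left _).add (hQ.mul_left _))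
  have hfin := hasSum_h1 hU hS
  refine ⟨hfin.summable, ?_⟩
  rw [h1Norm, hfin.tsum_eq]
  have hNq : N = Real.sqrt Real.pi * q := by rw [hq]; field_simp
  refine Real.sqrt_le_iff.2 ⟨by positivity, ?_⟩
  calc Real.pi * S ≤ Real.pi * (M + (A * M + B * q)) ^ 2 := by gcongr
    _ = (Real.sqrt Real.pi * (M + (A * M + B * q))) ^ 2 := by rw [mul_pow, hsp2]
    _ = _ := by rw [hNq, hM]; ring

theorem chebCoeff_congr {f g : ℝ → ℂ} (h : EqOn f g (Icc (-1 : ℝ) 1)) : chebCoeff f = chebCoeff g := by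
  funext k
  refine intervalIntegral.integral_congr fun t ht => ?_
  rw [uIcc_of_le (by norm_num)] at ht
  simp only [h ht]

theorem Uop_congr {a b f a' b' f' : ℝ → ℂ} (ha : EqOn a a' (Icc (-1 : ℝ) 1))
    (hb : EqOn b b' (Icc (-1 : ℝ) 1)) (hf : EqOn f f' (Icc (-1 : ℝ) 1)) :
    EqOn (Uop a b f) (Uop a' b' f') (Icc (-1 : ℝ) 1) := by
  have hPhi : EqOn (Phi a) (Phi a') (Icc (-1 : ℝ) 1) := by
    intro t ht
    rw [Phi, Phi]
    congr 1
    refine intervalIntegral.integral_congr fun s hs => ?_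
    rw [uIcc_of_le ht.1] at hs
    exact ha ⟨hs.1, hs.2.trans ht.2⟩
  intro t ht
  rw [Uop, Uop, hPhi ht, hf ⟨by norm_num, le_rfl⟩]
  congr 2
  refine intervalIntegral.integral_congr fun s hs => ?_
  rw [uIcc_of_le ht.1] at hs
  have hs' : s ∈ Icc (-1 : ℝ) 1 := ⟨hs.1, hs.2.trans ht.2⟩
  simp only [hPhi hs', hb hs', hf hs']

theorem exists_ext {f : ℝ → ℂ} (hf : ContinuousOn f (Icc (-1 : ℝ) 1)) :
    ∃ f' : ℝ → ℂ, Continuous f' ∧ EqOn f f' (Icc (-1 : ℝ) 1) :=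
  ⟨IccExtend (by norm_num : (-1 : ℝ) ≤ 1) ((Icc (-1 : ℝ) 1).domRestrict f),
    hf.domRestrict.Icc_extend', fun t ht => by rw [IccExtend_of_mem _ _ ht]; rfl⟩

theorem le_supNorm {f : ℝ → ℂ} (hf : ContinuousOn f (Icc (-1 : ℝ) 1)) (t : ℝ)
    (ht : t ∈ Icc (-1 : ℝ) 1) : ‖f t‖ ≤ supNorm f := by
  have hb : BddAbove (range fun t : Icc (-1 : ℝ) 1 => ‖f t‖) := by
    obtain ⟨K, hK⟩ := isCompact_Icc.exists_bound_of_continuousOn hf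
    exact ⟨K, by rintro _ ⟨t, rfl⟩; exact hK t t.2⟩
  exact le_ciSup hb (⟨t, ht⟩ : Icc (-1 : ℝ) 1)

/-- norm bound for the monodromy operator on `H¹`. -/
theorem monodromy_operator_h1_norm_bound
    (a b : ℝ → ℂ)
    (ha : ContinuousOn a (Icc (-1 : ℝ) 1)) (hb : ContinuousOn b (Icc (-1 : ℝ) 1))
    (Ca : ℝ) (hCa : Ca = Real.exp (∫ s in (-1 : ℝ)..1, max (a s).re 0))
    (c0 c1 c2 : ℝ)
    (hc0 : c0 = supNorm b)
    (hc1 : c1 = 2.3 * (1 + supNorm a) + Real.pi * supNorm b)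
    (hc2 : c2 = Real.pi * Real.sqrt 2 * supNorm a * supNorm b) :
    ∀ f : ℝ → ℂ, ContinuousOn f (Icc (-1 : ℝ) 1) →
      Summable (fun k : ℕ => ((1 : ℝ) + k) ^ 2 * ‖chebCoeff f k‖ ^ 2) →
      Summable (fun k : ℕ => ((1 : ℝ) + k) ^ 2 * ‖chebCoeff (Uop a b f) k‖ ^ 2)
      ∧ h1Norm (Uop a b f) ≤ (c0 + c1 * Ca + c2 * Ca ^ 2) * h1Norm f := by
  intro f hf hs
  obtain ⟨a', ha', ea⟩ := exists_ext ha
  obtain ⟨b', hb', eb⟩ := exists_ext hb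
  obtain ⟨f', hf', ef⟩ := exists_ext hf
  have hCe : Ca = Real.exp (∫ s in (-1 : ℝ)..1, max (a' s).re 0) := by
    rw [hCa]
    congr 1
    refine intervalIntegral.integral_congr fun s hs => ?_
    rw [uIcc_of_le (by norm_num)] at hs
    simp only [ea hs]
  have hC1 : 1 ≤ Ca := by
    rw [hCa]
    refine Real.one_le_exp (intervalIntegral.integral_nonneg (by norm_num) fun s _ => ?_)
    exact le_max_right _ _
  have key := main_cont ha' hb' hf' (A := supNorm a) (B := supNorm b)
    (fun t ht => ea ht ▸ le_supNorm ha t ht) (fun t ht => eb ht ▸ le_supNorm hb t ht) hCe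
    (by rw [← chebCoeff_congr ef]; exact hs)
  have hA0 : 0 ≤ supNorm a := Real.iSup_nonneg fun t => norm_nonneg _
  have hB0 : 0 ≤ supNorm b := Real.iSup_nonneg fun t => norm_nonneg _
  have hUe := chebCoeff_congr (Uop_congr ea eb ef)
  rw [h1Norm, h1Norm, ← hUe, ← chebCoeff_congr ef] at key
  refine ⟨key.1, key.2.trans ?_⟩
  rw [h1Norm]
  refine mul_le_mul_of_nonneg_right ?_ (Real.sqrt_nonneg _)
  rw [hc0, hc1, hc2]
  have hp := Real.pi_pos
  have h2 : (1 : ℝ) ≤ Real.sqrt 2 := Real.one_le_sqrt.2 (by norm_num)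
  have h3 : Real.pi * supNorm a * supNorm b * Ca ≤
      Real.pi * Real.sqrt 2 * supNorm a * supNorm b * Ca ^ 2 := by
    have e1 : Real.pi * 1 ≤ Real.pi * Real.sqrt 2 := by gcongr
    have e2 : Ca ≤ Ca ^ 2 := by nlinarith
    rw [mul_one] at e1
    gcongr
  have h4 : (2 * (1 + supNorm a) + Real.pi * supNorm b) * Ca ≤
      (2.3 * (1 + supNorm a) + Real.pi * supNorm b) * Ca := by
    gcongr
    norm_num
  linarith
end
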